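/- arXiv:math/0508358 — 2 statements merged into one kernel-verified Lean document; each statement's English description precedes it below -/
import Mathlib

section
/- Let (R,m) be a Noetherian local ring of positive prime characteristic p, and let B be a balanced big Cohen-Macaulay R-algebra that is reduced, quasilocal, and m-adically separated (∩_{k≥1} m^k B = 0). If C is a ring extension of B that is finitely generated as a B-module, then C is a seed over R. -/
open IsLocalRing

universe u v w

/-- `x` is a system of parameters of the local ring `R`: a sequence of `dim R` elements
of the maximal ideal generating an ideal primary to the maximal ideal. -/
def IsSOP (R : Type*) [CommRing R] [IsLocalRing R] {n : ℕ} (x : Fin n → R) : Prop :=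
  (n : WithBot ℕ∞) = ringKrullDim R ∧
  (∀ i, x i ∈ maximalIdeal R) ∧
  (Ideal.span (Set.range x)).radical = maximalIdeal R

/-- The sequence `x` of elements of `R` is a regular sequence on the `R`-module `M`. -/
def IsRegSeq (R : Type*) [CommRing R] (M : Type*) [AddCommGroup M] [Module R M]
    {n : ℕ} (x : Fin n → R) : Prop :=
  RingTheory.Sequence.IsRegular M (List.ofFn x)

/-- `B` is a big Cohen-Macaulay algebra over the local ring `R`: some system of
parameters of `R` is a regular sequence on `B` (and in particular `mB ≠ B`). -/
def IsBigCM (R : Type*) [CommRing R] [IsLocalRing R]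
    (B : Type*) [CommRing B] [Algebra R B] : Prop :=
  (∃ (n : ℕ) (x : Fin n → R), IsSOP R x ∧ IsRegSeq R B x) ∧
  (maximalIdeal R).map (algebraMap R B) ≠ ⊤

/-- `B` is a balanced big Cohen-Macaulay algebra over the local ring `R`: every system of
parameters of `R` is a regular sequence on `B` (and in particular `mB ≠ B`). -/
def IsBalancedBigCM (R : Type*) [CommRing R] [IsLocalRing R]
    (B : Type*) [CommRing B] [Algebra R B] : Prop :=
  (∀ (n : ℕ) (x : Fin n → R), IsSOP R x → IsRegSeq R B x) ∧
  (maximalIdeal R).map (algebraMap R B) ≠ ⊤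

/-- `S` is a seed over the local ring `R`: `S` admits an `R`-algebra homomorphism to some
big Cohen-Macaulay `R`-algebra. -/
def IsSeed (R : Type u) [CommRing R] [IsLocalRing R]
    (S : Type v) [CommRing S] [Algebra R S] : Prop :=
  ∃ (B : Type (max u v)) (_ : CommRing B) (_ : Algebra R B),
    IsBigCM R B ∧ Nonempty (S →ₐ[R] B)

section FactorsThroughFree

variable {B : Type*} [CommRing B]

/-- Multiplication by `b` on the module `M` factors through a finite free module. -/
def FactorsThroughFree (b : B) (M : Type*) [AddCommGroup M] [Module B M] : Prop :=
  ∃ (r : ℕ) (u : M →ₗ[B] Fin r → B) (v : (Fin r → B) →ₗ[B] M), ∀ y, v (u y) = b • y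

variable {M N : Type*} [AddCommGroup M] [Module B M] [AddCommGroup N] [Module B N]

theorem FactorsThroughFree.of_comp {a b : B} (hN : FactorsThroughFree b N)
    (i : M →ₗ[B] N) (q : N →ₗ[B] M) (h : ∀ y, q (i y) = a • y) :
    FactorsThroughFree (a * b) M := by
  obtain ⟨r, u, v, huv⟩ := hN
  refine ⟨r, u ∘ₗ i, q ∘ₗ v, fun y => ?_⟩
  simp [huv, h, mul_smul, smul_comm a b]

theorem FactorsThroughFree.of_surjective {a b : B} (hN : FactorsThroughFree b N)
    (q : N →ₗ[B] M) (hq : Function.Surjective q) (h : ∀ y, q y = 0 → a • y = 0) :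
    FactorsThroughFree (a * b) M := by
  let i : M →ₗ[B] N :=
    (LinearMap.ker q).liftQ (a • LinearMap.id) (fun y hy => LinearMap.mem_ker.2 (h y (LinearMap.mem_ker.1 hy))) ∘ₗ
      (q.quotKerEquivOfSurjective hq).symm.toLinearMap
  refine hN.of_comp i q fun y => ?_
  obtain ⟨z, rfl⟩ := hq y
  have : (q.quotKerEquivOfSurjective hq).symm (q z) = Submodule.Quotient.mk z := by
    rw [LinearEquiv.symm_apply_eq]
    rfl
  simp [i, this]

theorem FactorsThroughFree.prod {b : B} (hN : FactorsThroughFree b N) :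
    FactorsThroughFree b (B × N) := by
  obtain ⟨r, u, v, huv⟩ := hN
  let e := Fin.consLinearEquiv B (fun _ : Fin (r + 1) => B)
  refine ⟨r + 1, e.toLinearMap ∘ₗ LinearMap.prodMap (b • LinearMap.id) u,
    LinearMap.prodMap LinearMap.id v ∘ₗ e.symm.toLinearMap, fun y => ?_⟩
  ext <;> simp [huv]

theorem exists_factorsThroughFree_sup_span_singleton [IsReduced B] (N : Submodule B M) (x : M)
    {b : B} (hb : b ≠ 0) (hN : FactorsThroughFree b N) :
    ∃ c : B, c ≠ 0 ∧ FactorsThroughFree c ↥(N ⊔ Submodule.span B {x}) := by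
  by_cases h : ∃ a : B, a • x ∈ N ∧ a * b ≠ 0
  · obtain ⟨a, hax, hab⟩ := h
    refine ⟨a * b, hab, hN.of_comp
      (LinearMap.codRestrict N (a • (N ⊔ Submodule.span B {x}).subtype) ?_)
      (Submodule.inclusion le_sup_left) fun y => rfl⟩
    rintro ⟨y, hy⟩
    obtain ⟨n, hn, _, hx, rfl⟩ := Submodule.mem_sup.1 hy
    obtain ⟨t, rfl⟩ := Submodule.mem_span_singleton.1 hx
    simpa [smul_comm a t] using N.add_mem (N.smul_mem a hn) (N.smul_mem t hax)
  · push Not at h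
    refine ⟨b * b, fun h0 => hb (pow_eq_zero_iff two_ne_zero |>.1 (by rwa [sq])), hN.prod.of_surjective
      (LinearMap.codRestrict _
        (LinearMap.coprod (LinearMap.toSpanSingleton B M x) N.subtype) ?_) ?_ ?_⟩
    · rintro ⟨t, n⟩
      exact Submodule.add_mem _ (Submodule.mem_sup_right (Submodule.mem_span_singleton.2 ⟨t, rfl⟩))
        (Submodule.mem_sup_left n.2)
    · rintro ⟨y, hy⟩
      obtain ⟨n, hn, _, hx, rfl⟩ := Submodule.mem_sup.1 hy
      obtain ⟨t, rfl⟩ := Submodule.mem_span_singleton.1 hx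
      exact ⟨(t, ⟨n, hn⟩), Subtype.ext (add_comm _ _)⟩
    · rintro ⟨t, n⟩ htn
      have htn : t • x + (n : M) = 0 := congrArg Subtype.val htn
      have ht : t * b = 0 := h t (by
        rw [eq_neg_of_add_eq_zero_left htn]
        exact N.neg_mem n.2)
      rw [mul_comm] at ht
      refine Prod.ext ht (Subtype.ext ?_)
      simpa [smul_smul, ht] using congrArg (b • ·) htn

theorem exists_factorsThroughFree [IsReduced B] [Nontrivial B] [Module.Finite B M] :
    ∃ b : B, b ≠ 0 ∧ FactorsThroughFree b M := by
  have key : ∀ s : Finset M,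
      ∃ b : B, b ≠ 0 ∧ FactorsThroughFree b (Submodule.span B (s : Set M)) := by
    classical
    intro s
    induction s using Finset.induction_on with
    | empty =>
      refine ⟨1, one_ne_zero, 0, 0, 0, fun y => ?_⟩
      have : Subsingleton (Submodule.span B ((∅ : Finset M) : Set M)) := by
        simp only [Finset.coe_empty, Submodule.span_empty]; infer_instance
      exact Subsingleton.elim _ _
    | insert x s _ ih =>
      obtain ⟨b, hb, hN⟩ := ih
      rw [Finset.coe_insert, Submodule.span_insert, sup_comm]
      exact exists_factorsThroughFree_sup_span_singleton _ x hb hN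
  obtain ⟨s, hs⟩ := Module.Finite.fg_top (R := B) (M := M)
  obtain ⟨b, hb, h⟩ := key s
  rw [hs] at h
  refine ⟨b, hb, ?_⟩
  simpa using h.of_comp (a := 1) Submodule.topEquiv.symm.toLinearMap
    Submodule.topEquiv.toLinearMap (fun y => by simp)

end FactorsThroughFree

section RegularSequences

variable {R : Type*} [CommRing R] {M : Type*} [AddCommGroup M] [Module R M] {n : ℕ}

theorem mem_ofList_take_smul_top_iff (x : Fin n → R) (k : ℕ) (z : M) :
    z ∈ (Ideal.ofList ((List.ofFn x).take k) • ⊤ : Submodule R M) ↔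
      ∃ m : Fin n → M, z = ∑ j with j.val < k, x j • m j := by
  have hset : {r | r ∈ (List.ofFn x).take k} =
      x '' ((Finset.univ.filter fun j : Fin n => (j : ℕ) < k : Finset (Fin n)) : Set (Fin n)) := by
    ext r
    simp only [Set.mem_ofPred_eq, List.mem_take_iff_getElem, List.length_ofFn, List.getElem_ofFn,
      Set.mem_image, Finset.coe_filter, Finset.mem_univ, true_and]
    constructor
    · rintro ⟨i, hi, rfl⟩
      exact ⟨⟨i, by omega⟩, by simp; omega, rfl⟩
    · rintro ⟨j, hj, rfl⟩
      exact ⟨j, by omega, rfl⟩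
  rw [Ideal.ofList, hset]
  constructor
  · intro hz
    induction hz using Submodule.smul_induction_on' with
    | smul r hr y _ =>
      obtain ⟨c, rfl⟩ := (Submodule.mem_span_image_finset_iff_exists_fun R).1 hr
      refine ⟨fun j => if h : (j : ℕ) < k then c ⟨j, by simpa using h⟩ • y else 0, ?_⟩
      rw [Finset.sum_smul, ← Finset.sum_coe_sort (Finset.univ.filter fun j : Fin n => j.val < k)]
      refine Fintype.sum_congr _ _ fun j => ?_
      beta_reduce
      rw [dif_pos (Finset.mem_filter.1 j.2).2, smul_smul, smul_eq_mul, mul_comm]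
    | add y _ y' _ h h' =>
      obtain ⟨m, rfl⟩ := h
      obtain ⟨m', rfl⟩ := h'
      exact ⟨m + m', by simp [Finset.sum_add_distrib]⟩
  · rintro ⟨m, rfl⟩
    exact Submodule.sum_mem _ fun j hj => Submodule.smul_mem_smul
      (Ideal.subset_span (Set.mem_image_of_mem x hj)) Submodule.mem_top

/-- The elementwise form of weak regularity of `x` on `M`. -/
theorem isWeaklyRegular_ofFn_iff (x : Fin n → R) :
    RingTheory.Sequence.IsWeaklyRegular M (List.ofFn x) ↔
      ∀ (k : Fin n) (z : M) (m : Fin n → M), x k • z = ∑ j with j < k, x j • m j →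
        ∃ m' : Fin n → M, z = ∑ j with j < k, x j • m' j := by
  rw [RingTheory.Sequence.isWeaklyRegular_iff]
  simp only [isSMulRegular_quotient_iff_mem_of_smul_mem, mem_ofList_take_smul_top_iff,
    List.getElem_ofFn, List.length_ofFn]
  constructor
  · intro h k z m hm
    exact h k k.2 z ⟨m, hm⟩
  · rintro h i hi z ⟨m, hm⟩
    exact h ⟨i, hi⟩ z m hm

/-- If multiplication by `b` on a `B`-module `C` factors through a finite free module, then a
sequence weakly regular on `B` is weakly regular on `C` up to multiplication by `b`. -/
theorem FactorsThroughFree.exists_smul_eq_sum {B C : Type*} [CommRing B] [Algebra R B]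
    [AddCommGroup C] [Module B C] [Module R C] [IsScalarTower R B C] {b : B}
    (hC : FactorsThroughFree b C) {x : Fin n → R}
    (hx : RingTheory.Sequence.IsWeaklyRegular B (List.ofFn x)) (k : Fin n) (z : C)
    (m : Fin n → C) (hm : x k • z = ∑ j with j < k, x j • m j) :
    ∃ m' : Fin n → C, b • z = ∑ j with j < k, x j • m' j := by
  rw [isWeaklyRegular_ofFn_iff] at hx
  obtain ⟨r, u, v, huv⟩ := hC
  have hu (t : Fin r) : ∃ m' : Fin n → B, u z t = ∑ j with j < k, x j • m' j := by
    refine hx k (u z t) (fun j => u (m j) t) ?_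
    have := congrFun (congrArg u hm) t
    rw [LinearMap.map_smul_of_tower, map_sum] at this
    simpa [LinearMap.map_smul_of_tower] using this
  choose m' hm' using hu
  refine ⟨fun j => v fun t => m' t j, ?_⟩
  rw [← huv, show u z = ∑ j with j < k, x j • (fun t => m' t j) from by
    ext t; simp [hm']]
  simp [map_sum, LinearMap.map_smul_of_tower]

end RegularSequences

section SystemsOfParameters

variable {R : Type*} [CommRing R] [IsLocalRing R]

theorem exists_isSOP [IsNoetherianRing R] : ∃ (n : ℕ) (x : Fin n → R), IsSOP R x := by
  obtain ⟨s, hs, hcard⟩ :=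
    (maximalIdeal R).exists_finset_card_eq_height_of_isNoetherianRing
  have hrange : Set.range (fun i => (s.equivFin.symm i : R)) = s := by
    ext r
    simp only [Set.mem_range, Finset.mem_coe]
    constructor
    · rintro ⟨i, rfl⟩
      exact (s.equivFin.symm i).2
    · intro hr
      exact ⟨s.equivFin ⟨r, hr⟩, by simp⟩
  refine ⟨s.card, fun i => s.equivFin.symm i, ?_, fun i => ?_, ?_⟩
  · rw [← maximalIdeal_height_eq_ringKrullDim, ← hcard]
    rfl
  · exact hs.1.2 (Ideal.subset_span (s.equivFin.symm i).2)
  · rw [hrange, Ideal.radical_eq_sInf]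
    refine le_antisymm (sInf_le ⟨hs.1.2, inferInstance⟩) (le_sInf ?_)
    rintro q ⟨hq, hprime⟩
    exact hs.2 ⟨hprime, hq⟩ (le_maximalIdeal hprime.ne_top)

theorem IsSOP.pow {n : ℕ} {x : Fin n → R} (hx : IsSOP R x) {q : ℕ} (hq : q ≠ 0) :
    IsSOP R fun i => x i ^ q := by
  refine ⟨hx.1, fun i => Ideal.pow_mem_of_mem _ (hx.2.1 i) q (Nat.pos_of_ne_zero hq), ?_⟩
  apply le_antisymm
  · refine Ideal.IsPrime.radical_le_iff inferInstance |>.2 (Ideal.span_le.2 ?_)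
    rintro _ ⟨i, rfl⟩
    exact Ideal.pow_mem_of_mem _ (hx.2.1 i) q (Nat.pos_of_ne_zero hq)
  · rw [← hx.2.2, Ideal.radical_le_radical_iff, Ideal.span_le]
    rintro _ ⟨i, rfl⟩
    exact ⟨q, Ideal.subset_span ⟨i, rfl⟩⟩

end SystemsOfParameters

section LocalizedProduct

variable {R C T : Type*} [CommRing R] [CommRing C] [CommRing T] [Algebra R T] [Algebra (ℕ → C) T]

theorem isWeaklyRegular_of_isLocalization_pi (b : C)
    [IsLocalization.Away (fun _ => b : ℕ → C) T] (ψ : ℕ → R →+* C)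
    (hψ : ∀ r, algebraMap R T r = algebraMap (ℕ → C) T fun i => ψ i r) {n : ℕ} (x : Fin n → R)
    (hx : ∀ (i : ℕ) (k : Fin n) (z : C) (m : Fin n → C),
      ψ i (x k) * z = ∑ j with j < k, ψ i (x j) * m j →
        ∃ m' : Fin n → C, b * z = ∑ j with j < k, ψ i (x j) * m' j) :
    RingTheory.Sequence.IsWeaklyRegular T (List.ofFn x) := by
  rw [isWeaklyRegular_ofFn_iff]
  intro k z m hm
  set β : ℕ → C := fun _ => b with hβ
  have hunit : IsUnit (algebraMap (ℕ → C) T β) := IsLocalization.Away.algebraMap_isUnit β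
  obtain ⟨⟨_, N, rfl⟩, hN⟩ := IsLocalization.exist_integer_multiples_of_finite
    (Submonoid.powers β) (fun o : Option (Fin n) => o.elim z m)
  obtain ⟨z', hz'⟩ := hN none
  choose m' hm' using fun j => hN (some j)
  simp only [Option.elim, Algebra.smul_def] at hz' hm'
  have h0 : algebraMap (ℕ → C) T ((fun i => ψ i (x k)) * z') =
      algebraMap (ℕ → C) T (∑ j with j < k, (fun i => ψ i (x j)) * m' j) := by
    simp only [map_mul, map_sum, ← hψ, hz', hm']
    simp only [Algebra.smul_def] at hm
    rw [mul_left_comm, hm, Finset.mul_sum]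
    exact Finset.sum_congr rfl fun j _ => mul_left_comm _ _ _
  obtain ⟨⟨_, K, rfl⟩, hK⟩ := (IsLocalization.eq_iff_exists (Submonoid.powers β) T).1 h0
  have hcomp (i : ℕ) : ∃ m'' : Fin n → C,
      b * (b ^ K * z' i) = ∑ j with j < k, ψ i (x j) * m'' j := by
    refine hx i k _ (fun j => b ^ K * m' j i) ?_
    have := congrFun hK i
    simp only [Pi.mul_apply, Finset.sum_apply, Pi.pow_apply, hβ, Finset.mul_sum] at this
    rw [mul_left_comm, this]
    exact Finset.sum_congr rfl fun j _ => mul_left_comm _ _ _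
  choose m'' hm'' using hcomp
  have h1 : algebraMap (ℕ → C) T (β * (β ^ K * z')) =
      ∑ j with j < k, algebraMap R T (x j) * algebraMap (ℕ → C) T (fun i => m'' i j) := by
    simp only [hψ, ← map_mul, ← map_sum]
    congr 1
    ext i
    simpa [hβ] using hm'' i
  obtain ⟨c, hc⟩ := ((hunit.mul (hunit.pow K)).mul (hunit.pow N)).exists_left_inv
  refine ⟨fun j => c * algebraMap (ℕ → C) T (fun i => m'' i j), ?_⟩
  simp only [Algebra.smul_def, mul_left_comm _ c, ← Finset.mul_sum]
  rw [← h1, map_mul, map_mul, hz', map_pow, map_pow]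
  linear_combination -z * hc

theorem map_ne_top_of_isLocalization_pi (b : C)
    [IsLocalization.Away (fun _ => b : ℕ → C) T] (ψ : ℕ → R →+* C)
    (hψ : ∀ r, algebraMap R T r = algebraMap (ℕ → C) T fun i => ψ i r) (I : Ideal R)
    (hI : ∀ N : ℕ, ∃ i, b ^ N ∉ I.map (ψ i)) : I.map (algebraMap R T) ≠ ⊤ := by
  have hcomp : algebraMap R T = (algebraMap (ℕ → C) T).comp (RingHom.pi ψ) := RingHom.ext hψ
  rw [hcomp, ← Ideal.map_map,
    IsLocalization.map_algebraMap_ne_top_iff_disjoint (Submonoid.powers (fun _ => b : ℕ → C)),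
    Set.disjoint_left]
  rintro _ ⟨N, rfl⟩ hN
  obtain ⟨i, hi⟩ := hI N
  have := Ideal.mem_map_of_mem (Pi.evalRingHom (fun _ : ℕ => C) i) hN
  rw [Ideal.map_map] at this
  exact hi this

end LocalizedProduct

theorem FactorsThroughFree.exists_linearMap {B C : Type*} [CommRing B] [IsReduced B] [CommRing C]
    [Algebra B C] (hinj : Function.Injective (algebraMap B C)) {b : B} (hb : b ≠ 0)
    (hC : FactorsThroughFree b C) : ∃ g : C →ₗ[B] B, ∀ N : ℕ, b ^ N * g 1 ≠ 0 := by
  obtain ⟨r, u, v, huv⟩ := hC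
  obtain ⟨t, ht⟩ : ∃ t, b * u 1 t ≠ 0 := by
    by_contra! h
    have h1 : b • u 1 = 0 := funext h
    have h2 : (b * b) • (1 : C) = 0 := by
      rw [mul_smul, ← huv 1, ← map_smul, h1, map_zero]
    rw [← Algebra.algebraMap_eq_smul_one, map_eq_zero_iff _ hinj] at h2
    exact pow_ne_zero 2 hb (by rwa [sq])
  refine ⟨LinearMap.proj t ∘ₗ u, fun N hN => ?_⟩
  refine pow_ne_zero (N + 1) ht ?_
  calc (b * u 1 t) ^ (N + 1) = b ^ N * u 1 t * (b * u 1 t ^ N) := by ring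
    _ = 0 := by
      rw [show b ^ N * u 1 t = 0 from hN, zero_mul]

theorem LinearMap.mem_of_mem_ideal_map {B C : Type*} [CommRing B] [CommRing C] [Algebra B C]
    (g : C →ₗ[B] B) {I : Ideal B} {y : C} (hy : y ∈ I.map (algebraMap B C)) : g y ∈ I := by
  replace hy : y ∈ (I • ⊤ : Submodule B C) := by
    rw [Ideal.smul_top_eq_map]
    exact hy
  induction hy using Submodule.smul_induction_on' with
  | smul r hr y _ =>
    rw [map_smul]
    exact I.mul_mem_right _ hr
  | add y _ y' _ h h' =>
    rw [map_add]
    exact I.add_mem h h'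


/-- **Lemma (Dietz, Lem. 6.9 / `mfck`).** Let `(R,m)` be a Noetherian local ring of
positive prime characteristic `p`, and let `B` be a reduced, quasilocal, `m`-adically
separated balanced big Cohen-Macaulay `R`-algebra. If `C` is a module-finite ring
extension of `B`, then `C` is a seed over `R`. -/
theorem module_finite_extension_of_nice_bigCM_is_seed
    (R : Type u) [CommRing R] [IsLocalRing R] [IsNoetherianRing R]
    (p : ℕ) [Fact p.Prime] [CharP R p]
    (B : Type v) [CommRing B] [Algebra R B]
    (hB : IsBalancedBigCM R B) [IsReduced B] [IsLocalRing B]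
    (hsep : (⨅ k : ℕ, ((maximalIdeal R) ^ (k + 1)).map (algebraMap R B)) = ⊥)
    (C : Type w) [CommRing C] [Algebra B C]
    (hinj : Function.Injective (algebraMap B C)) [Module.Finite B C]
    [Algebra R C] [IsScalarTower R B C] :
    IsSeed R C := by
  have hBnt : Nontrivial B := by
    by_contra h
    rw [not_nontrivial_iff_subsingleton] at h
    exact hB.2 (Subsingleton.elim _ _)
  have : Nontrivial C := hinj.nontrivial
  have : CharP C p := by
    rw [CharP.charP_iff_prime_eq_zero Fact.out, ← map_natCast (algebraMap R C),
      CharP.cast_eq_zero, map_zero]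
  obtain ⟨b, hb, hC⟩ := exists_factorsThroughFree (B := B) (M := C)
  obtain ⟨g, hg⟩ := hC.exists_linearMap hinj hb
  set ψ : ℕ → R →+* C := fun i => (iterateFrobenius C p i).comp (algebraMap R C) with hψ
  have hψ_apply (i : ℕ) (r : R) : ψ i r = algebraMap R C (r ^ p ^ i) := by
    simp [hψ, iterateFrobenius_def]
  let β : ℕ → C := fun _ => algebraMap B C b
  obtain ⟨L, _, _, hL⟩ : ∃ (L : Type (max u w)) (_ : CommRing L) (_ : Algebra (ℕ → C) L),
      IsLocalization.Away β L :=
    ⟨ULift.{u} (Localization.Away β), inferInstance, inferInstance,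
      IsLocalization.isLocalization_of_algEquiv _ (ULift.algEquiv (R := ℕ → C)).symm⟩
  let F : C →+* L := (algebraMap (ℕ → C) L).comp (RingHom.pi fun i => iterateFrobenius C p i)
  let algL : Algebra R L := (F.comp (algebraMap R C)).toAlgebra
  have hT : (maximalIdeal R).map (algebraMap R L) ≠ ⊤ := by
    refine map_ne_top_of_isLocalization_pi (algebraMap B C b) ψ (fun r => rfl) _ fun N => ?_
    by_contra! hN
    refine hg N ?_
    rw [← Ideal.mem_bot, ← hsep, Ideal.mem_iInf]
    intro k
    rw [← smul_eq_mul, ← map_smul, Algebra.smul_def, mul_one, map_pow]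
    refine g.mem_of_mem_ideal_map ?_
    rw [Ideal.map_map, ← IsScalarTower.algebraMap_eq]
    refine Ideal.map_le_iff_le_comap.2 (fun r hr => ?_) (hN k)
    rw [Ideal.mem_comap, hψ_apply]
    exact Ideal.mem_map_of_mem _ (Ideal.pow_le_pow_right
      (Nat.lt_pow_self (Fact.out : p.Prime).one_lt) (Ideal.pow_mem_pow hr _))
  obtain ⟨n, x, hx⟩ := exists_isSOP (R := R)
  refine ⟨L, inferInstance, algL, ⟨⟨n, x, hx, ?_⟩, hT⟩,
    ⟨{ F with commutes' := fun r => rfl }⟩⟩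
  refine ⟨isWeaklyRegular_of_isLocalization_pi (algebraMap B C b) ψ (fun r => rfl) x
    fun i k z m hm => ?_, fun htop => hT ?_⟩
  · have hq : IsRegSeq R B fun j => x j ^ p ^ i :=
      hB.1 n _ (hx.pow (pow_ne_zero i (Fact.out : p.Prime).ne_zero))
    simp only [hψ_apply, ← Algebra.smul_def] at hm ⊢
    exact hC.exists_smul_eq_sum hq.toIsWeaklyRegular k z m hm
  · have hle : Ideal.ofList (List.ofFn x) ≤ maximalIdeal R := Ideal.span_le.2 fun r hr => by
      obtain ⟨j, rfl⟩ := List.mem_ofFn.1 hr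
      exact hx.2.1 j
    have := htop.le.trans (Submodule.smul_mono_left hle)
    rw [Ideal.smul_top_eq_map, top_le_iff] at this
    exact (Submodule.restrictScalars_eq_top_iff R L L).1 this
end

section
/- Let S be a commutative ring, let T be a ring extension of S that is integral over S, and let B be a ring extension of S that is reduced. Then the natural ring homomorphism B → T ⊗_S B, b ↦ 1 ⊗ b, is injective. -/
open IsLocalRing

universe u v w

/-- If `T` is an integral ring extension of `S`, every ring homomorphism from `S` to an
algebraically closed field extends to `T`. -/
theorem nonempty_algHom_of_isIntegral_of_isAlgClosed
    {S T K : Type*} [CommRing S] [CommRing T] [Algebra S T] [Algebra.IsIntegral S T]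
    (hT : Function.Injective (algebraMap S T)) [Field K] [IsAlgClosed K] [Algebra S K] :
    Nonempty (T →ₐ[S] K) := by
  have := RingHom.ker_isPrime (algebraMap S K)
  obtain ⟨Q, -, hQ, hQS⟩ := Ideal.exists_ideal_over_prime_of_isIntegral
    (RingHom.ker (algebraMap S K)) (⊥ : Ideal T)
    (by rw [← RingHom.ker_eq_comap_bot, (RingHom.injective_iff_ker_eq_bot _).1 hT]; exact bot_le)
  let P := Q.under S
  have hP : P = RingHom.ker (algebraMap S K) := hQS
  let φ : S ⧸ P →+* K := Ideal.Quotient.lift P (algebraMap S K) fun a ha ↦ by rwa [hP] at ha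
  have hφ : Function.Injective φ := RingHom.lift_injective_of_ker_le_ideal _ _ hP.ge
  let : Algebra (S ⧸ P) K := φ.toAlgebra
  have : FaithfulSMul (S ⧸ P) K := (faithfulSMul_iff_algebraMap_injective _ _).2 hφ
  have : IsScalarTower S (S ⧸ P) K := .of_algebraMap_eq fun _ ↦ rfl
  have : IsDomain (T ⧸ Q) := Ideal.Quotient.isDomain Q
  have : Module.IsTorsionFree (S ⧸ P) (T ⧸ Q) := Module.isTorsionFree_iff_faithfulSMul.2
    ((faithfulSMul_iff_algebraMap_injective _ _).2 Ideal.algebraMap_quotient_injective)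
  let g : T ⧸ Q →ₐ[S ⧸ P] K := IsAlgClosed.lift
  exact ⟨(g.restrictScalars S).comp (Ideal.Quotient.mkₐ S Q)⟩

/-- **Lemma (Dietz, Lem. 6.3).** Let `S` be a commutative ring, `T` an integral ring
extension of `S`, and `B` a reduced ring extension of `S`. Then the natural map
`B → T ⊗_S B`, `b ↦ 1 ⊗ b`, is injective. -/
theorem includeRight_injective_of_integral_of_reduced
    (S : Type u) [CommRing S]
    (T : Type v) [CommRing T] [Algebra S T]
    (hT : Function.Injective (algebraMap S T)) [Algebra.IsIntegral S T]
    (B : Type w) [CommRing B] [Algebra S B]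
    (hB : Function.Injective (algebraMap S B)) [IsReduced B] :
    Function.Injective (Algebra.TensorProduct.includeRight : B →ₐ[S] TensorProduct S T B) := by
  rw [injective_iff_map_eq_zero]
  intro b hb
  refine (nilpotent_iff_mem_prime.2 fun p hp ↦ ?_ : IsNilpotent b).eq_zero
  let K := AlgebraicClosure p.ResidueField
  obtain ⟨g⟩ := nonempty_algHom_of_isIntegral_of_isAlgClosed (K := K) hT
  have h := congrArg (Algebra.TensorProduct.lift g (IsScalarTower.toAlgHom S B K)
    fun _ _ ↦ .all _ _) hb
  rw [← Ideal.algebraMap_residueField_eq_zero (I := p),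
    ← map_eq_zero (algebraMap p.ResidueField K), ← IsScalarTower.algebraMap_apply]
  simpa using h
end
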